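/- Let A be a real m×n matrix, let V be a real n×n orthogonal matrix (Vᵀ V = I = V Vᵀ), and let D be a real n×n diagonal matrix all of whose diagonal entries are positive, such that Aᵀ A = V D Vᵀ. Define S as the n×n diagonal matrix with S i i = Real.sqrt (D i i), and define U = A * V * S⁻¹. Then Uᵀ U = I and A = U * S * Vᵀ; that is, U, S, V form an economic singular value decomposition of A. -/

import Mathlib

open Matrix

theorem eigSVD_correct {m n : ℕ}
    (A : Matrix (Fin m) (Fin n) ℝ) (V D : Matrix (Fin n) (Fin n) ℝ)
    (hV₁ : Vᵀ * V = 1) (hV₂ : V * Vᵀ = 1)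
    (hDdiag : D.IsDiag) (hDpos : ∀ i, 0 < D i i)
    (hA : Aᵀ * A = V * D * Vᵀ)
    (S : Matrix (Fin n) (Fin n) ℝ)
    (hS : S = Matrix.diagonal fun i => Real.sqrt (D i i))
    (U : Matrix (Fin m) (Fin n) ℝ)
    (hU : U = A * V * S⁻¹) :
    Uᵀ * U = 1 ∧ A = U * S * Vᵀ := by
  have hSS : S * S = D := by
    rw [hS, diagonal_mul_diagonal]
    simp only [Real.mul_self_sqrt (hDpos _).le]
    exact hDdiag.diagonal_diag
  have hST : Sᵀ = S := by rw [hS, diagonal_transpose]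
  have hdet : IsUnit S.det := by
    rw [hS, det_diagonal]
    exact (Finset.prod_pos fun i _ => Real.sqrt_pos.2 (hDpos i)).ne'.isUnit
  subst hU
  constructor
  · calc (A * V * S⁻¹)ᵀ * (A * V * S⁻¹)
        = S⁻¹ * (Vᵀ * (Aᵀ * A) * V) * S⁻¹ := by
          simp only [transpose_mul, transpose_nonsing_inv, hST, Matrix.mul_assoc]
      _ = S⁻¹ * ((Vᵀ * V) * D * (Vᵀ * V)) * S⁻¹ := by
          simp only [hA, Matrix.mul_assoc]
      _ = (S⁻¹ * S) * (S * S⁻¹) := by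
          simp only [hV₁, ← hSS, Matrix.one_mul, Matrix.mul_one, Matrix.mul_assoc]
      _ = 1 := by rw [nonsing_inv_mul S hdet, mul_nonsing_inv S hdet, Matrix.one_mul]
  · rw [nonsing_inv_mul_cancel_right _ _ hdet, Matrix.mul_assoc, hV₂, Matrix.mul_one]
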